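/- Assume k is even. Then the kernel of L̄ is the free rank-one ℂ[z]-submodule ℂ[z]·ū, where ū = Σ_{i=0}^{k/2} (−1)^i·binomial(k/2, i)·z^{k/2−i}·ū_{2i}. -/

import Mathlib

open Polynomial

/-- The graded operator `L̄` on the free `ℂ[z]`-module with basis `ū_0, …, ū_k`:
`L̄(ū_a) = (k−a)·z·ū_{a+1} + a·z²·ū_{a−1}`. -/
noncomputable def Lbar (k : ℕ) :
    (Fin (k + 1) → Polynomial ℂ) →ₗ[Polynomial ℂ] (Fin (k + 1) → Polynomial ℂ) :=
  LinearMap.pi fun b =>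
    (if 1 ≤ (b : ℕ) then
      (((k - ((b : ℕ) - 1) : ℕ) : Polynomial ℂ) * X) •
        LinearMap.proj ⟨(b : ℕ) - 1, by have := b.isLt; omega⟩
    else 0)
    + (if h : (b : ℕ) + 1 ≤ k then
        ((((b : ℕ) + 1 : ℕ) : Polynomial ℂ) * X ^ 2) •
          LinearMap.proj ⟨(b : ℕ) + 1, by omega⟩
      else 0)

/-- The element `ū = Σ_{i=0}^{k/2} (−1)^i·C(k/2,i)·z^{k/2−i}·ū_{2i}` (for `k` even). -/
noncomputable def ubar (k : ℕ) : Fin (k + 1) → Polynomial ℂ :=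
  fun b => if (b : ℕ) % 2 = 0 then
      (-1 : Polynomial ℂ) ^ ((b : ℕ) / 2) * ((k / 2).choose ((b : ℕ) / 2) : Polynomial ℂ)
        * X ^ (k / 2 - (b : ℕ) / 2)
    else 0

theorem Lbar_apply (k : ℕ) (v : Fin (k + 1) → ℂ[X]) (b : Fin (k + 1)) :
    Lbar k v b =
      (if 1 ≤ (b : ℕ) then
        ((k - ((b : ℕ) - 1) : ℕ) : ℂ[X]) * X * v ⟨(b : ℕ) - 1, by omega⟩ else 0)
      + (if h : (b : ℕ) + 1 ≤ k then
        (((b : ℕ) + 1 : ℕ) : ℂ[X]) * X ^ 2 * v ⟨(b : ℕ) + 1, by omega⟩ else 0) := by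
  simp only [Lbar, LinearMap.pi_apply, LinearMap.add_apply]
  congr 1 <;> split_ifs <;> simp

/-- A kernel element of `Lbar k` is determined by its last coordinate. -/
theorem eq_zero_of_Lbar_eq_zero {k : ℕ} {v : Fin (k + 1) → ℂ[X]} (hv : Lbar k v = 0)
    (hlast : v (Fin.last k) = 0) : v = 0 := by
  have key : ∀ d n : ℕ, ∀ hn : n < k + 1, n + d = k → v ⟨n, hn⟩ = 0 := by
    intro d
    induction d using Nat.strong_induction_on with
    | _ d ih =>
      intro n hn hnd
      obtain rfl | hd := Nat.eq_zero_or_pos d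
      · obtain rfl : n = k := by omega
        exact hlast
      · have h := congrFun hv ⟨n + 1, by omega⟩
        rw [Lbar_apply] at h
        have hnext : ∀ h' : n + 1 + 1 ≤ k, v ⟨n + 1 + 1, by omega⟩ = 0 :=
          fun h' => ih (d - 2) (by omega) _ _ (by omega)
        have hkn : ((k - n : ℕ) : ℂ[X]) ≠ 0 := by
          exact_mod_cast (by omega : k - n ≠ 0)
        by_cases h' : n + 1 + 1 ≤ k
        · simpa [h', hnext h', hkn, -Nat.cast_sub] using h
        · simpa [h', hkn, -Nat.cast_sub] using h
  funext b
  exact key (k - b) b b.isLt (by omega)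

theorem Lbar_ubar {k : ℕ} (hke : Even k) : Lbar k (ubar k) = 0 := by
  obtain ⟨m, rfl⟩ := hke
  funext ⟨b, hb⟩
  rw [Lbar_apply]
  obtain ⟨j, rfl | rfl⟩ := Nat.even_or_odd' b
  · have h₁ : 1 ≤ 2 * j → (2 * j - 1) % 2 ≠ 0 := by omega
    have h₂ : (2 * j + 1) % 2 ≠ 0 := by omega
    simp +contextual only [ubar, h₁, h₂, if_false, mul_zero, ite_self, dite_eq_ite, add_zero,
      Pi.zero_apply]
  · obtain ⟨t, rfl⟩ : ∃ t, m = j + 1 + t := ⟨m - (j + 1), by omega⟩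
    have hm : (j + 1 + t + (j + 1 + t)) / 2 = j + 1 + t := by omega
    have hj : (2 * j + 1 + 1) / 2 = j + 1 := by omega
    have hc := congrArg (Nat.cast (R := ℂ[X])) (Nat.choose_succ_right_eq (j + 1 + t) j)
    rw [show j + 1 + t - j = t + 1 by omega] at hc
    have hs : j + 1 + t + (j + 1 + t) - 2 * j = 2 * (t + 1) := by omega
    simp only [ubar, hm, hj, Nat.add_sub_cancel, Nat.mul_mod_right, hs,
      show (2 * j + 1 + 1) % 2 = 0 by omega, show 2 * j / 2 = j by omega,
      show 1 ≤ 2 * j + 1 by omega, show 2 * j + 1 + 1 ≤ j + 1 + t + (j + 1 + t) by omega,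
      if_true, dite_true, show j + 1 + t - j = t + 1 by omega,
      show j + 1 + t - (j + 1) = t by omega, Pi.zero_apply]
    push_cast at hc ⊢
    linear_combination (-2 * (-1) ^ j * X ^ (t + 2) : ℂ[X]) * hc

theorem ubar_last {k : ℕ} (hke : Even k) : ubar k (Fin.last k) = (-1) ^ (k / 2) := by
  simp [ubar, Nat.even_iff.mp hke]

/-- For `k` even, the kernel of `L̄` is the free rank-one `ℂ[z]`-submodule generated by `ū`. -/
theorem stmt_10 (k : ℕ) (hk : 1 ≤ k) (hke : Even k) :
    LinearMap.ker (Lbar k) = Submodule.span (Polynomial ℂ) {ubar k} ∧ ubar k ≠ 0 := by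
  have hlast := ubar_last hke
  refine ⟨le_antisymm (fun v hv => ?_) ?_, fun h => ?_⟩
  · rw [Submodule.mem_span_singleton]
    refine ⟨v (Fin.last k) * (-1) ^ (k / 2), Eq.symm (sub_eq_zero.mp ?_)⟩
    apply eq_zero_of_Lbar_eq_zero
    · rw [map_sub, map_smul, Lbar_ubar hke, LinearMap.mem_ker.mp hv, smul_zero, sub_zero]
    · simp [hlast, mul_assoc, ← mul_pow]
  · rw [Submodule.span_singleton_le_iff_mem]
    exact Lbar_ubar hke
  · rw [h, Pi.zero_apply] at hlast
    exact pow_ne_zero _ (neg_ne_zero.mpr one_ne_zero) hlast.symm
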